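/- Let Ω ⊆ ℂ be a Z-invariant open set and let f : ℂ → ℂ be holomorphic on Ω. Then there exists a unique pair of functions f₁, f₂ : ℂ → ℂ, both holomorphic on Ω, such that f₁ satisfies the C-property on Ω, f₂ satisfies the anti-C-property on Ω, and f(z) = f₁(z) + f₂(z) for all z ∈ Ω (uniqueness means: any two such pairs agree on Ω). -/

import Mathlib

open MeasureTheory Complex

local notation "conj" => (starRingEnd ℂ)

/-- `Ω` is invariant under complex conjugation. -/
def ZInvariant (Ω : Set ℂ) : Prop := ∀ z ∈ Ω, conj z ∈ Ω

/-- `f` is holomorphic on `Ω`: complex-differentiable at every point of `Ω`. -/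
def HolomorphicOn (Ω : Set ℂ) (f : ℂ → ℂ) : Prop := ∀ z ∈ Ω, DifferentiableAt ℂ f z

/-- `f` satisfies the C-property on `Ω`. -/
def CProp (Ω : Set ℂ) (f : ℂ → ℂ) : Prop := ∀ z ∈ Ω, f (conj z) = conj (f z)

/-- `f` satisfies the anti-C-property on `Ω`. -/
def AntiCProp (Ω : Set ℂ) (f : ℂ → ℂ) : Prop := ∀ z ∈ Ω, f (conj z) = -conj (f z)

theorem HolomorphicOn.conj_conj {Ω : Set ℂ} (hZ : ZInvariant Ω) {f : ℂ → ℂ}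
    (hf : HolomorphicOn Ω f) : HolomorphicOn Ω (fun z => conj (f (conj z))) := by
  intro z hz
  have h := (hf _ (hZ z hz)).conj_conj
  rwa [Complex.conj_conj] at h

theorem stmt0 (Ω : Set ℂ) (hopen : IsOpen Ω) (hZ : ZInvariant Ω)
    (f : ℂ → ℂ) (hf : HolomorphicOn Ω f) :
    ∃ f₁ f₂ : ℂ → ℂ,
      (HolomorphicOn Ω f₁ ∧ HolomorphicOn Ω f₂ ∧ CProp Ω f₁ ∧ AntiCProp Ω f₂ ∧
        ∀ z ∈ Ω, f z = f₁ z + f₂ z) ∧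
      (∀ g₁ g₂ : ℂ → ℂ,
        (HolomorphicOn Ω g₁ ∧ HolomorphicOn Ω g₂ ∧ CProp Ω g₁ ∧ AntiCProp Ω g₂ ∧
          ∀ z ∈ Ω, f z = g₁ z + g₂ z) →
        ∀ z ∈ Ω, g₁ z = f₁ z ∧ g₂ z = f₂ z) := by
  have hc := hf.conj_conj hZ
  refine ⟨fun z => (f z + conj (f (conj z))) / 2, fun z => (f z - conj (f (conj z))) / 2,
    ⟨fun z hz => ((hf z hz).add (hc z hz)).div_const 2,
      fun z hz => ((hf z hz).sub (hc z hz)).div_const 2, fun z _ => ?_, fun z _ => ?_,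
      fun z _ => by ring⟩, ?_⟩
  · simp [add_comm, Complex.conj_ofNat]
  · simp [← neg_div, Complex.conj_ofNat]
  · rintro g₁ g₂ ⟨-, -, h₁, h₂, h⟩ z hz
    have hcz : conj (f (conj z)) = g₁ z - g₂ z := by
      rw [h _ (hZ z hz), h₁ z hz, h₂ z hz]
      simp [sub_eq_add_neg]
    simp only [hcz, h z hz]
    constructor <;> ring
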